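/- Let Q ≥ 1 be an integer, let k be an integer with 0 ≤ k ≤ Q−1, and let β ∈ (0,1). Define f : ℝ → ℝ by f(ι) = (β/(Q+1))·Σ_{q=k}^{Q} C(q,k)·ι^{q−k} − C(Q,k)·ι^{Q−k}. Then for all ι₁, ι₂ ∈ (0,1) with ι₁ < ι₂, if f(ι₁) = 0 then f(ι₂) < 0; in particular f has at most one zero in (0,1). -/

import Mathlib

theorem pow_mul_pow_lt_pow_mul_pow {a b : ℝ} (ha : 0 < a) (hab : a < b) {m n : ℕ}
    (hmn : m < n) : b ^ m * a ^ n < a ^ m * b ^ n := by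
  obtain ⟨d, rfl⟩ := Nat.exists_eq_add_of_lt hmn
  have hb : 0 < b := ha.trans hab
  have h : a ^ (d + 1) < b ^ (d + 1) := pow_lt_pow_left₀ hab ha.le d.succ_ne_zero
  calc b ^ m * a ^ (m + d + 1) = (a ^ m * b ^ m) * a ^ (d + 1) := by ring
    _ < (a ^ m * b ^ m) * b ^ (d + 1) := by gcongr
    _ = a ^ m * b ^ (m + d + 1) := by ring

theorem sum_choose_mul_pow_mul_pow_lt {a b : ℝ} (ha : 0 < a) (hab : a < b) {k Q : ℕ}
    (hk : k < Q) :
    (∑ q ∈ Finset.Icc k Q, (q.choose k : ℝ) * b ^ (q - k)) * a ^ (Q - k) <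
      (∑ q ∈ Finset.Icc k Q, (q.choose k : ℝ) * a ^ (q - k)) * b ^ (Q - k) := by
  simp only [Finset.sum_mul, mul_assoc]
  refine Finset.sum_lt_sum (fun q hq => ?_) ⟨k, Finset.left_mem_Icc.2 hk.le, ?_⟩
  · obtain ⟨hkq, hqQ⟩ := Finset.mem_Icc.1 hq
    refine mul_le_mul_of_nonneg_left ?_ (Nat.cast_nonneg _)
    rcases hqQ.eq_or_lt with rfl | hlt
    · exact (mul_comm _ _).le
    · exact (pow_mul_pow_lt_pow_mul_pow ha hab (by lia)).le
  · simpa using pow_lt_pow_left₀ hab ha.le (Nat.sub_ne_zero_of_lt hk)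

/-- For integers `Q ≥ 1`, `0 ≤ k ≤ Q - 1`, and `β ∈ (0,1)`, the function
`f(ι) = (β/(Q+1)) · ∑_{q=k}^{Q} C(q,k) · ι^{q-k} − C(Q,k) · ι^{Q-k}` satisfies: for all
`ι₁, ι₂ ∈ (0,1)` with `ι₁ < ι₂`, if `f(ι₁) = 0` then `f(ι₂) < 0`; in particular `f` has at
most one zero in `(0,1)`. -/
theorem scenario_polynomial_at_most_one_root (Q k : ℕ) (hQ : 1 ≤ Q) (hk : k ≤ Q - 1)
    (β : ℝ) (hβ : β ∈ Set.Ioo (0 : ℝ) 1) (f : ℝ → ℝ)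
    (hf : ∀ ι : ℝ, f ι =
      (β / (Q + 1)) * (∑ q ∈ Finset.Icc k Q, (q.choose k : ℝ) * ι ^ (q - k))
        - (Q.choose k : ℝ) * ι ^ (Q - k)) :
    (∀ ι₁ ∈ Set.Ioo (0 : ℝ) 1, ∀ ι₂ ∈ Set.Ioo (0 : ℝ) 1,
        ι₁ < ι₂ → f ι₁ = 0 → f ι₂ < 0) ∧
      ∀ ι₁ ∈ Set.Ioo (0 : ℝ) 1, ∀ ι₂ ∈ Set.Ioo (0 : ℝ) 1,
        f ι₁ = 0 → f ι₂ = 0 → ι₁ = ι₂ := by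
  have hneg : ∀ a ∈ Set.Ioo (0 : ℝ) 1, ∀ b ∈ Set.Ioo (0 : ℝ) 1,
      a < b → f a = 0 → f b < 0 := by
    intro a ha b _ hab hfa
    have hc : 0 < β / ((Q : ℝ) + 1) := div_pos hβ.1 (by positivity)
    have h := mul_lt_mul_of_pos_left
      (sum_choose_mul_pow_mul_pow_lt ha.1 hab (show k < Q by lia)) hc
    have hfba : f b * a ^ (Q - k) < f a * b ^ (Q - k) := by
      rw [hf, hf]
      linarith
    rw [hfa, zero_mul] at hfba
    exact neg_of_mul_neg_left hfba (pow_pos ha.1 _).le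
  refine ⟨hneg, fun a ha b hb hfa hfb => ?_⟩
  rcases lt_trichotomy a b with hab | hab | hab
  · exact absurd hfb (hneg a ha b hb hab hfa).ne
  · exact hab
  · exact absurd hfa (hneg b hb a ha hab hfb).ne
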